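/- Under the hypotheses of Proposition 2 — 𝒳 ⊂ ℝ^{d+1} compact and contained in a Euclidean ball of radius R; p a probability density on ℝ^{d+1} with σ_p² = ∫ ‖ω‖² p(ω) dω < ∞; ω_1, …, ω_D i.i.d. with density p; K(δ) = ∫ cos(ωᵀδ) p(ω) dω and K̂_D(δ) = (1/D) Σ_{k=1}^D cos(ω_kᵀδ); 0 < ε ≤ 24 R σ_p — suppose additionally that δ' ∈ (0, 1) and D ≥ (4(d+3)/ε²) · log( (48 R σ_p / ε)² / δ' ). Then ℙ{ sup_{x, x' ∈ 𝒳} | K̂_D(x − x') − K(x − x') | ≥ ε } ≤ δ'. -/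

import Mathlib

open MeasureTheory Real Set
open scoped RealInnerProductSpace ENNReal

section Covering

open Metric Module

variable {E : Type*} [NormedAddCommGroup E] [NormedSpace ℝ E] [FiniteDimensional ℝ E]

/-- Volumetric bound on the cardinality of an `r`-separated subset of a ball of radius `ρ`. -/
theorem card_mul_pow_le_of_separated {r ρ : ℝ} (hr : 0 < r) (hρ : 0 ≤ ρ) (s : Finset E)
    (hs : ∀ c ∈ s, ‖c‖ ≤ ρ) (h : ∀ c ∈ s, ∀ c' ∈ s, c ≠ c' → r ≤ ‖c - c'‖) :
    (s.card : ℝ) * r ^ finrank ℝ E ≤ (2 * ρ + r) ^ finrank ℝ E := by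
  borelize E
  let μ : Measure E := Measure.addHaar
  have hdisj : (s : Set E).PairwiseDisjoint fun c => ball c (r / 2) := by
    intro c hc c' hc' hcc
    apply ball_disjoint_ball
    rw [dist_eq_norm]
    linarith [h c hc c' hc' hcc]
  have hsub : (⋃ c ∈ s, ball c (r / 2)) ⊆ ball (0 : E) (ρ + r / 2) := by
    refine iUnion₂_subset fun x hx => ball_subset_ball' ?_
    rw [dist_zero_right]
    linarith [hs x hx]
  have hvol : (s.card : ℝ≥0∞) * ENNReal.ofReal ((r / 2) ^ finrank ℝ E) * μ (ball 0 1) ≤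
      ENNReal.ofReal ((ρ + r / 2) ^ finrank ℝ E) * μ (ball 0 1) :=
    calc
      _ = μ (⋃ c ∈ s, ball c (r / 2)) := by
        rw [measure_biUnion_finset hdisj fun c _ => measurableSet_ball]
        simp only [μ.addHaar_ball_of_pos _ (half_pos hr), Finset.sum_const, nsmul_eq_mul, mul_assoc]
      _ ≤ μ (ball (0 : E) (ρ + r / 2)) := measure_mono hsub
      _ = _ := μ.addHaar_ball_of_pos _ (by positivity)
  have hcard := ENNReal.toReal_le_of_le_ofReal (by positivity)
    ((ENNReal.mul_le_mul_iff_left (measure_ball_pos _ _ zero_lt_one).ne' measure_ball_lt_top.ne).1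
      hvol)
  rw [ENNReal.toReal_mul, ENNReal.toReal_natCast, ENNReal.toReal_ofReal (by positivity)] at hcard
  calc (s.card : ℝ) * r ^ finrank ℝ E
      = 2 ^ finrank ℝ E * (s.card * (r / 2) ^ finrank ℝ E) := by
        rw [div_pow]; field_simp
    _ ≤ 2 ^ finrank ℝ E * (ρ + r / 2) ^ finrank ℝ E := by gcongr
    _ = (2 * ρ + r) ^ finrank ℝ E := by rw [← mul_pow]; ring

/-- A ball of radius `ρ` in dimension `n` is covered by at most `(3 * ρ / r) ^ n` balls of
radius `r ≤ 3 * ρ`. -/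
theorem exists_finset_cover_card_mul_pow_le {r ρ : ℝ} (hr : 0 < r) (hrρ : r ≤ 3 * ρ) :
    ∃ s : Finset E, (∀ x : E, ‖x‖ ≤ ρ → ∃ c ∈ s, ‖x - c‖ ≤ r) ∧
      (s.card : ℝ) * r ^ finrank ℝ E ≤ (3 * ρ) ^ finrank ℝ E := by
  classical
  rcases le_total ρ r with hle | hle
  · refine ⟨{0}, fun x hx => ⟨0, by simp, by simpa using hx.trans hle⟩, ?_⟩
    simpa using pow_le_pow_left₀ hr.le hrρ _
  · have hρ : 0 ≤ ρ := by linarith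
    let S : Set ℕ := {n | ∃ s : Finset E, s.card = n ∧ (∀ c ∈ s, ‖c‖ ≤ ρ) ∧
      ∀ c ∈ s, ∀ c' ∈ s, c ≠ c' → r ≤ ‖c - c'‖}
    have hbdd : BddAbove S := by
      refine ⟨⌊(2 * ρ + r) ^ finrank ℝ E / r ^ finrank ℝ E⌋₊, ?_⟩
      rintro _ ⟨s, rfl, hs, hsep⟩
      apply Nat.le_floor
      rw [le_div_iff₀ (by positivity)]
      exact card_mul_pow_le_of_separated hr hρ s hs hsep
    obtain ⟨s, hcard, hs, hsep⟩ : sSup S ∈ S := Nat.sSup_mem ⟨0, ∅, by simp⟩ hbdd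
    refine ⟨s, fun x hx => ?_, (card_mul_pow_le_of_separated hr hρ s hs hsep).trans ?_⟩
    · by_contra! hfar
      have hxs : x ∉ s := fun hmem => by
        have := hfar x hmem
        simp at this
        linarith
      have hmem : s.card + 1 ∈ S := by
        refine ⟨insert x s, Finset.card_insert_of_notMem hxs, ?_, ?_⟩
        · simpa using ⟨hx, hs⟩
        · intro c hc c' hc' hne
          rcases Finset.mem_insert.1 hc with rfl | hcs <;>
            rcases Finset.mem_insert.1 hc' with rfl | hcs'
          · exact absurd rfl hne
          · exact (hfar c' hcs').le
          · rw [norm_sub_rev]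
            exact (hfar c hcs).le
          · exact hsep c hcs c' hcs' hne
      have := le_csSup hbdd hmem
      omega
    · gcongr
      linarith

end Covering

section Concentration

open ProbabilityTheory

variable {Ω : Type*} [MeasurableSpace Ω] {μ : Measure Ω} [IsProbabilityMeasure μ] {D : ℕ}

theorem integral_sq_le_integral_sq {h : Ω → ℝ} (hh : MemLp h 2 μ) :
    (∫ ω, h ω ∂μ) ^ 2 ≤ ∫ ω, h ω ^ 2 ∂μ := by
  have := variance_nonneg h μ
  rw [variance_eq_sub hh] at this
  simpa using this

/-- One-sided **Hoeffding inequality** for the empirical mean of an i.i.d. sample. -/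
theorem measureReal_pi_sum_sub_integral_ge_le {g : Ω → ℝ} (hg : Measurable g)
    (hg1 : ∀ ω, |g ω| ≤ 1) {t : ℝ} (ht : 0 ≤ t) :
    (Measure.pi fun _ : Fin D => μ).real {ωs | D * t ≤ ∑ k, (g (ωs k) - ∫ ω, g ω ∂μ)} ≤
      exp (-(D * t ^ 2 / 2)) := by
  rcases Nat.eq_zero_or_pos D with rfl | hD
  · simp
  have hindep : iIndepFun (fun (k : Fin D) ωs => g (ωs k) - ∫ ω, g ω ∂μ)
      (Measure.pi fun _ => μ) :=
    iIndepFun_pi (X := fun _ ω => g ω - ∫ ω, g ω ∂μ) fun _ => (hg.sub_const _).aemeasurable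
  have hsub : ∀ k ∈ (Finset.univ : Finset (Fin D)), HasSubgaussianMGF
      (fun ωs : Fin D → Ω => g (ωs k) - ∫ ω, g ω ∂μ) 1 (Measure.pi fun _ => μ) := by
    intro k _
    have := hasSubgaussianMGF_of_mem_Icc (μ := Measure.pi fun _ : Fin D => μ)
      (X := fun ωs => g (ωs k)) (a := -1) (b := 1)
      (hg.comp (measurable_pi_apply k)).aemeasurable
      (Filter.Eventually.of_forall fun ωs => abs_le.1 (hg1 (ωs k)))
    rw [integral_comp_eval (μ := fun _ : Fin D => μ) (i := k) hg.aestronglyMeasurable] at this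
    convert this
    ext
    norm_num
  have := HasSubgaussianMGF.measure_sum_ge_le_of_iIndepFun hindep hsub
    (ε := D * t) (by positivity)
  refine this.trans_eq ?_
  have : (D : ℝ) ≠ 0 := by positivity
  congr 1
  simp
  field_simp

/-- Two-sided **Hoeffding inequality** for the empirical mean of an i.i.d. sample. -/
theorem measureReal_pi_abs_mean_sub_integral_ge_le (hD : 0 < D) {g : Ω → ℝ} (hg : Measurable g)
    (hg1 : ∀ ω, |g ω| ≤ 1) {t : ℝ} (ht : 0 ≤ t) :
    (Measure.pi fun _ : Fin D => μ).real
        {ωs | t ≤ |1 / (D : ℝ) * ∑ k, g (ωs k) - ∫ ω, g ω ∂μ|} ≤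
      2 * exp (-(D * t ^ 2 / 2)) := by
  have hD' : (0 : ℝ) < D := by exact_mod_cast hD
  have h1 := measureReal_pi_sum_sub_integral_ge_le (μ := μ) (D := D) hg hg1 ht
  have h2 := measureReal_pi_sum_sub_integral_ge_le (μ := μ) (D := D) hg.neg
    (fun ω => by simpa using hg1 ω) ht
  rw [two_mul]
  refine (measureReal_mono ?_).trans ((measureReal_union_le _ _).trans (add_le_add h1 h2))
  intro ωs hωs
  have heq : ∑ k, (g (ωs k) - ∫ ω, g ω ∂μ) =
      D * (1 / (D : ℝ) * ∑ k, g (ωs k) - ∫ ω, g ω ∂μ) := by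
    simp [Finset.sum_sub_distrib]
    field_simp
  have heq' : ∑ k, ((-g) (ωs k) - ∫ ω, (-g) ω ∂μ) =
      D * -(1 / (D : ℝ) * ∑ k, g (ωs k) - ∫ ω, g ω ∂μ) := by
    rw [mul_neg, ← heq, ← Finset.sum_neg_distrib]
    refine Finset.sum_congr rfl fun k _ => ?_
    simp [integral_neg]
    ring
  simp only [mem_union, mem_ofPred_eq] at hωs ⊢
  rw [heq, heq', mul_le_mul_iff_right₀ hD', mul_le_mul_iff_right₀ hD']
  exact le_abs.1 hωs

/-- Second-moment tail bound for the sum of the empirical mean and the mean. -/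
theorem measureReal_pi_mean_add_integral_ge_le (hD : 0 < D) {h : Ω → ℝ} (hh : MemLp h 2 μ)
    {t : ℝ} (ht : 0 < t) :
    (Measure.pi fun _ : Fin D => μ).real
        {ωs | t ≤ 1 / (D : ℝ) * ∑ k, h (ωs k) + ∫ ω, h ω ∂μ} ≤
      4 * (∫ ω, h ω ^ 2 ∂μ) / t ^ 2 := by
  have hD' : (0 : ℝ) < D := by exact_mod_cast hD
  have hint : Integrable (fun ω => h ω ^ 2) μ := hh.integrable_sq
  set M := ∫ ω, h ω ^ 2 ∂μ with hM
  have hM0 : 0 ≤ M := integral_nonneg fun ω => sq_nonneg _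
  let G : (Fin D → Ω) → ℝ := fun ωs => 2 / (D : ℝ) * ∑ k, h (ωs k) ^ 2 + 2 * M
  have hcomp (k : Fin D) :
      Integrable (fun ωs : Fin D → Ω => h (ωs k) ^ 2) (Measure.pi fun _ => μ) :=
    integrable_comp_eval (μ := fun _ : Fin D => μ) (i := k) hint
  have hsum : Integrable (fun ωs : Fin D → Ω => 2 / (D : ℝ) * ∑ k, h (ωs k) ^ 2)
      (Measure.pi fun _ => μ) :=
    (integrable_finsetSum _ fun k _ => hcomp k).const_mul _
  have hG : ∫ ωs, G ωs ∂(Measure.pi fun _ : Fin D => μ) = 4 * M := by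
    have hk (k : Fin D) : ∫ ωs : Fin D → Ω, h (ωs k) ^ 2 ∂(Measure.pi fun _ => μ) = M :=
      integral_comp_eval (μ := fun _ : Fin D => μ) (i := k) (f := fun ω => h ω ^ 2) hint.1
    simp only [G]
    rw [integral_add hsum (integrable_const _), integral_const_mul,
      integral_finsetSum _ fun k _ => hcomp k]
    simp only [hk]
    simp
    field_simp
    ring
  have hmarkov := mul_meas_ge_le_integral_of_nonneg (μ := Measure.pi fun _ : Fin D => μ)
    (f := G) (Filter.Eventually.of_forall fun ωs => by
      simp only [G, Pi.zero_apply]; positivity) (hsum.add (integrable_const _)) (t ^ 2)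
  rw [hG] at hmarkov
  rw [le_div_iff₀ (by positivity), mul_comm]
  refine (mul_le_mul_of_nonneg_left (measureReal_mono ?_) (by positivity)).trans hmarkov
  intro ωs hωs
  simp only [mem_ofPred_eq, G] at hωs ⊢
  have hmean : (1 / (D : ℝ) * ∑ k, h (ωs k)) ^ 2 ≤ 1 / (D : ℝ) * ∑ k, h (ωs k) ^ 2 := by
    have := sq_sum_le_card_mul_sum_sq (s := Finset.univ) (f := fun k => h (ωs k))
    simp only [Finset.card_univ, Fintype.card_fin] at this
    rw [mul_pow, ← sub_nonneg]
    have h2 : 0 ≤ 1 / (D : ℝ) ^ 2 * (D * ∑ k, h (ωs k) ^ 2 - (∑ k, h (ωs k)) ^ 2) :=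
      mul_nonneg (by positivity) (sub_nonneg.2 this)
    convert h2 using 1
    field_simp
  have hsq := integral_sq_le_integral_sq hh
  set a := 1 / (D : ℝ) * ∑ k, h (ωs k)
  set b := ∫ ω, h ω ∂μ
  have h3 : t ^ 2 ≤ (a + b) ^ 2 := pow_le_pow_left₀ ht.le hωs 2
  have h4 : 2 / (D : ℝ) * ∑ k, h (ωs k) ^ 2 = 2 * (1 / (D : ℝ) * ∑ k, h (ωs k) ^ 2) := by ring
  nlinarith [sq_nonneg (a - b)]

end Concentration

section RandomFourierFeatures

open Module

theorem abs_cos_inner_sub_cos_inner_le {E : Type*} [NormedAddCommGroup E]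
    [InnerProductSpace ℝ E] (ω x y : E) :
    |cos ⟪ω, x⟫ - cos ⟪ω, y⟫| ≤ ‖ω‖ * ‖x - y‖ := by
  refine (Real.abs_cos_sub_cos_le _ _).trans ?_
  rw [← inner_sub_right]
  exact abs_real_inner_le_norm _ _

variable {E : Type*} [NormedAddCommGroup E] [InnerProductSpace ℝ E] [FiniteDimensional ℝ E]
  [MeasurableSpace E] [BorelSpace E] {μ : Measure E} [IsProbabilityMeasure μ] {D : ℕ}

theorem integrable_cos_inner (x : E) : Integrable (fun ω => cos ⟪ω, x⟫) μ :=
  .of_bound (by fun_prop) 1 (.of_forall fun ω => abs_cos_le_one _)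

/-- The deviation of the random Fourier feature estimator is Lipschitz. -/
theorem abs_mean_cos_sub_integral_sub_le (hint : Integrable (fun ω : E => ‖ω‖) μ)
    (ωs : Fin D → E) (x y : E) :
    |(1 / (D : ℝ) * ∑ k, cos ⟪ωs k, x⟫ - ∫ ω, cos ⟪ω, x⟫ ∂μ) -
        (1 / (D : ℝ) * ∑ k, cos ⟪ωs k, y⟫ - ∫ ω, cos ⟪ω, y⟫ ∂μ)| ≤
      (1 / (D : ℝ) * ∑ k, ‖ωs k‖ + ∫ ω, ‖ω‖ ∂μ) * ‖x - y‖ := by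
  have hmean : |1 / (D : ℝ) * ∑ k, (cos ⟪ωs k, x⟫ - cos ⟪ωs k, y⟫)| ≤
      1 / (D : ℝ) * ((∑ k, ‖ωs k‖) * ‖x - y‖) := by
    rw [abs_mul, abs_of_nonneg (by positivity : 0 ≤ 1 / (D : ℝ)), Finset.sum_mul]
    gcongr
    exact (Finset.abs_sum_le_sum_abs _ _).trans
      (Finset.sum_le_sum fun k _ => abs_cos_inner_sub_cos_inner_le _ _ _)
  have hexp : |∫ ω, (cos ⟪ω, x⟫ - cos ⟪ω, y⟫) ∂μ| ≤ (∫ ω, ‖ω‖ ∂μ) * ‖x - y‖ := by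
    rw [← integral_mul_const]
    exact norm_integral_le_of_norm_le (f := fun ω => cos ⟪ω, x⟫ - cos ⟪ω, y⟫) (hint.mul_const _)
      (.of_forall fun ω => abs_cos_inner_sub_cos_inner_le ω x y)
  rw [integral_sub (integrable_cos_inner x) (integrable_cos_inner y)] at hexp
  rw [Finset.sum_sub_distrib, mul_sub] at hmean
  rw [sub_sub_sub_comm, add_mul, mul_assoc]
  exact (abs_sub _ _).trans (add_le_add hmean hexp)

/-- Uniform deviation bound for random Fourier features on a set contained in a ball of radius `R`,
in terms of the radius `r` of the underlying covering. -/
theorem measureReal_pi_iSup_abs_mean_cos_sub_integral_ge_le (hD : 0 < D)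
    (hμ : MemLp (fun ω : E => ‖ω‖) 2 μ) {X : Set E} {c : E} {R : ℝ}
    (hX : X ⊆ Metric.closedBall c R) {ε : ℝ} (hε : 0 < ε) {r : ℝ} (hr : 0 < r) (hrR : r ≤ 6 * R) :
    (Measure.pi fun _ : Fin D => μ).real {ωs | ε ≤ ⨆ x ∈ X, ⨆ x' ∈ X,
        |1 / (D : ℝ) * ∑ k, cos ⟪ωs k, x - x'⟫ - ∫ ω, cos ⟪ω, x - x'⟫ ∂μ|} ≤
      2 * (6 * R / r) ^ finrank ℝ E * exp (-(D * ε ^ 2 / 8)) +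
        16 * (∫ ω, ‖ω‖ ^ 2 ∂μ) * r ^ 2 / ε ^ 2 := by
  obtain ⟨s, hs, hcard⟩ := exists_finset_cover_card_mul_pow_le (E := E) (ρ := 2 * R) hr
    (by linarith)
  set P := Measure.pi fun _ : Fin D => μ
  let f : (Fin D → E) → E → ℝ := fun ωs x =>
    1 / (D : ℝ) * ∑ k, cos ⟪ωs k, x⟫ - ∫ ω, cos ⟪ω, x⟫ ∂μ
  let L : (Fin D → E) → ℝ := fun ωs => 1 / (D : ℝ) * ∑ k, ‖ωs k‖ + ∫ ω, ‖ω‖ ∂μ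
  have hint : Integrable (fun ω : E => ‖ω‖) μ := hμ.integrable one_le_two
  have hsub : {ωs | ε ≤ ⨆ x ∈ X, ⨆ x' ∈ X, |f ωs (x - x')|} ⊆
      (⋃ y ∈ s, {ωs | ε / 2 ≤ |f ωs y|}) ∪ {ωs | ε / (2 * r) ≤ L ωs} := by
    intro ωs hωs
    by_contra hnot
    simp only [mem_union, mem_iUnion, mem_ofPred_eq, not_or, not_exists, not_le] at hnot hωs
    obtain ⟨hnet, hL⟩ := hnot
    obtain ⟨m, hm0, hm, hmax⟩ : ∃ m, 0 ≤ m ∧ m < ε / 2 ∧ ∀ y ∈ s, |f ωs y| ≤ m := by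
      rcases s.eq_empty_or_nonempty with rfl | hne
      · exact ⟨0, le_rfl, half_pos hε, by simp⟩
      · obtain ⟨y, hy, hmax⟩ := s.exists_max_image (fun y => |f ωs y|) hne
        exact ⟨|f ωs y|, abs_nonneg _, hnet y hy, hmax⟩
    have hL0 : 0 ≤ L ωs := by
      have : 0 ≤ ∫ ω, ‖ω‖ ∂μ := integral_nonneg fun ω => norm_nonneg ω
      positivity
    have hLr : L ωs * r < ε / 2 := by
      rw [lt_div_iff₀ (by positivity)] at hL
      linarith
    have hbound0 : 0 ≤ m + L ωs * r := by positivity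
    refine (hωs.trans (Real.iSup_le (fun x => Real.iSup_le (fun hx => Real.iSup_le
      (fun x' => Real.iSup_le (fun hx' => ?_) hbound0) hbound0) hbound0) hbound0)).not_gt
      (show m + L ωs * r < ε by linarith)
    have hball : ‖x - x'‖ ≤ 2 * R := by
      have h1 := Metric.mem_closedBall.1 (hX hx)
      have h2 := Metric.mem_closedBall.1 (hX hx')
      rw [← dist_eq_norm]
      linarith [dist_triangle_right x x' c]
    obtain ⟨y, hy, hxy⟩ := hs _ hball
    have hlip : |f ωs (x - x') - f ωs y| ≤ L ωs * r :=
      (abs_mean_cos_sub_integral_sub_le hint ωs (x - x') y).trans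
        (mul_le_mul_of_nonneg_left hxy hL0)
    linarith [abs_sub_abs_le_abs_sub (f ωs (x - x')) (f ωs y), hmax y hy]
  have hnet : P.real (⋃ y ∈ s, {ωs | ε / 2 ≤ |f ωs y|}) ≤
      2 * (6 * R / r) ^ finrank ℝ E * exp (-(D * ε ^ 2 / 8)) := by
    have hpoint (y : E) : P.real {ωs | ε / 2 ≤ |f ωs y|} ≤ 2 * exp (-(D * ε ^ 2 / 8)) := by
      convert measureReal_pi_abs_mean_sub_integral_ge_le (μ := μ) (g := fun ω => cos ⟪ω, y⟫) hD
        (by fun_prop) (fun ω => abs_cos_le_one _) (half_pos hε).le using 4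
      ring
    calc P.real (⋃ y ∈ s, {ωs | ε / 2 ≤ |f ωs y|})
        ≤ ∑ y ∈ s, P.real {ωs | ε / 2 ≤ |f ωs y|} := measureReal_biUnion_finset_le _ _
      _ ≤ ∑ y ∈ s, 2 * exp (-(D * ε ^ 2 / 8)) := Finset.sum_le_sum fun y _ => hpoint y
      _ = 2 * s.card * exp (-(D * ε ^ 2 / 8)) := by
        rw [Finset.sum_const, nsmul_eq_mul]; ring
      _ ≤ _ := by
        gcongr
        rw [div_pow, le_div_iff₀ (by positivity), show 6 * R = 3 * (2 * R) by ring]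
        exact hcard
  have htail : P.real {ωs | ε / (2 * r) ≤ L ωs} ≤
      16 * (∫ ω, ‖ω‖ ^ 2 ∂μ) * r ^ 2 / ε ^ 2 := by
    refine (measureReal_pi_mean_add_integral_ge_le hD hμ (by positivity)).trans_eq ?_
    field_simp
    ring
  exact (measureReal_mono hsub).trans ((measureReal_union_le _ _).trans (add_le_add hnet htail))

end RandomFourierFeatures

/-- The arithmetic of the sample-complexity bound: with the covering radius chosen so that the
Lipschitz term is `δ / 2`, the covering term is also at most `δ / 2`. -/
theorem two_mul_pow_mul_exp_le {n : ℕ} {A δ s : ℝ} (hA : 1 ≤ 24 * A) (hδ : 0 < δ)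
    (hs : (n + 2) / 2 * log ((48 * A) ^ 2 / δ) ≤ s) :
    2 * (24 * A / √(δ / 2)) ^ n * exp (-s) ≤ δ / 2 := by
  have hA0 : 0 < A := by linarith
  set q := √(δ / 2) with hq
  have hq0 : 0 < q := by positivity
  have hq2 : q ^ 2 = δ / 2 := sq_sqrt (by positivity)
  have hexp : exp (-s) ≤ (√δ / (48 * A)) ^ (n + 2) := by
    have hpos : 0 < √δ / (48 * A) := by positivity
    rw [← exp_log (pow_pos hpos (n + 2)), exp_le_exp, log_pow]
    have : log ((48 * A) ^ 2 / δ) = -2 * log (√δ / (48 * A)) := by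
      rw [log_div (by positivity) hδ.ne', log_div (by positivity) (by positivity), log_pow,
        log_sqrt hδ.le]
      push_cast
      ring
    rw [this] at hs
    push_cast
    linarith
  have hratio : 24 * A / q * (√δ / (48 * A)) ≤ 1 := by
    have hle : √δ ≤ 2 * q := by
      rw [sqrt_le_left (by positivity)]
      nlinarith
    calc 24 * A / q * (√δ / (48 * A)) = √δ / (2 * q) := by field_simp; ring
      _ ≤ 1 := by rwa [div_le_one (by positivity)]
  calc 2 * (24 * A / q) ^ n * exp (-s)
      ≤ 2 * (24 * A / q) ^ n * (√δ / (48 * A)) ^ (n + 2) := by gcongr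
    _ = 2 * (24 * A / q * (√δ / (48 * A))) ^ n * (√δ / (48 * A)) ^ 2 := by
      rw [pow_add, mul_pow]; ring
    _ ≤ 2 * 1 * (√δ / (48 * A)) ^ 2 := by
      gcongr
      exact pow_le_one₀ (by positivity) hratio
    _ = 2 * (δ / (48 * A) ^ 2) := by rw [div_pow, sq_sqrt hδ.le]; ring
    _ ≤ 2 * (δ / 4) := by
      gcongr
      nlinarith
    _ = δ / 2 := by ring

/-- **Sample-complexity corollary of Proposition 2.** Under the hypotheses of
Proposition 2, if additionally `δ' ∈ (0, 1)` and
`D ≥ (4(d+3)/ε²) log((48Rσ_p/ε)²/δ')`, then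
`ℙ{ sup_{x,x'∈𝒳} |K̂_D(x−x') − K(x−x')| ≥ ε } ≤ δ'`. -/
theorem sample_complexity_random_fourier {d : ℕ}
    (X : Set (EuclideanSpace ℝ (Fin (d + 1)))) (hX_compact : IsCompact X)
    (R : ℝ) (hR : 0 < R) (c : EuclideanSpace ℝ (Fin (d + 1)))
    (hXR : X ⊆ Metric.closedBall c R)
    (p : EuclideanSpace ℝ (Fin (d + 1)) → ℝ) (hp_meas : Measurable p)
    (hp_nonneg : ∀ ω, 0 ≤ p ω) (hp_int : ∫ ω, p ω = 1)
    (sp : ℝ) (hsp_nonneg : 0 ≤ sp) (hsp : sp ^ 2 = ∫ ω, ‖ω‖ ^ 2 * p ω)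
    (K : EuclideanSpace ℝ (Fin (d + 1)) → ℝ)
    (hK : ∀ δ, K δ = ∫ ω, Real.cos ⟪ω, δ⟫ * p ω)
    (D : ℕ) (hD : 0 < D)
    (P : Measure (Fin D → EuclideanSpace ℝ (Fin (d + 1))))
    (hP : P = Measure.pi fun _ => volume.withDensity fun ω => ENNReal.ofReal (p ω))
    (ε : ℝ) (hε : 0 < ε) (hε' : ε ≤ 24 * R * sp)
    (δ' : ℝ) (hδ'0 : 0 < δ') (hδ'1 : δ' < 1)
    (hD' : (4 * ((d : ℝ) + 3) / ε ^ 2) * Real.log ((48 * R * sp / ε) ^ 2 / δ') ≤ (D : ℝ)) :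
    P {ωs | ε ≤ ⨆ x ∈ X, ⨆ x' ∈ X,
          |(1 / (D : ℝ)) * ∑ k, Real.cos ⟪ωs k, x - x'⟫ - K (x - x')|} ≤
      ENNReal.ofReal δ' := by
  have hRsp : 0 < 24 * R * sp := hε.trans_le hε'
  have hsp0 : 0 < sp := hsp_nonneg.lt_of_ne fun h => by simp [← h] at hRsp
  set μ : Measure (EuclideanSpace ℝ (Fin (d + 1))) :=
    volume.withDensity fun ω => ENNReal.ofReal (p ω) with hμ
  have hp_integrable : Integrable p := by
    by_contra h
    simp [integral_undef h] at hp_int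
  have hμ_integral (g : EuclideanSpace ℝ (Fin (d + 1)) → ℝ) :
      ∫ ω, g ω ∂μ = ∫ ω, g ω * p ω := by
    rw [hμ, integral_withDensity_eq_integral_toReal_smul hp_meas.ennreal_ofReal (by simp)]
    refine integral_congr_ae (.of_forall fun ω => ?_)
    simp [ENNReal.toReal_ofReal (hp_nonneg ω), mul_comm]
  have : IsProbabilityMeasure μ := ⟨by
    rw [hμ, withDensity_apply _ .univ, setLIntegral_univ,
      ← ofReal_integral_eq_lintegral_ofReal hp_integrable (.of_forall hp_nonneg), hp_int,
      ENNReal.ofReal_one]⟩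
  have hμ_memLp : MemLp (fun ω => ‖ω‖) 2 μ := by
    rw [memLp_two_iff_integrable_sq (by fun_prop)]
    by_contra h
    have h0 := hμ_integral fun ω => ‖ω‖ ^ 2
    rw [integral_undef h, ← hsp] at h0
    exact (pow_pos hsp0 2).ne h0
  have hsq : ∫ ω, ‖ω‖ ^ 2 ∂μ = sp ^ 2 := (hμ_integral _).trans hsp.symm
  set A := R * sp / ε with hA
  have hA1 : 1 ≤ 24 * A := by
    rw [hA, ← mul_div_assoc, one_le_div hε]
    linarith
  set q := √(δ' / 2) with hq
  have hq0 : 0 < q := by positivity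
  have hq2 : q ^ 2 = δ' / 2 := sq_sqrt (by positivity)
  have hq1 : q ≤ 1 := by nlinarith
  set r := ε * q / (4 * sp) with hr
  have hr0 : 0 < r := by positivity
  have hrR : r ≤ 6 * R := by
    rw [hr, div_le_iff₀ (by positivity)]
    nlinarith
  have hmain := measureReal_pi_iSup_abs_mean_cos_sub_integral_ge_le hD hμ_memLp hXR hε hr0 hrR
  have hcover : 2 * (24 * A / q) ^ (d + 1) * exp (-(D * ε ^ 2 / 8)) ≤ δ' / 2 := by
    refine two_mul_pow_mul_exp_le hA1 hδ'0 ?_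
    have h48 : 48 * R * sp / ε = 48 * A := by rw [hA]; ring
    rw [h48, div_mul_eq_mul_div, div_le_iff₀ (by positivity)] at hD'
    push_cast
    linarith
  have hratio : 6 * R / r = 24 * A / q := by
    rw [hr, hA]
    field_simp
    ring
  have hlip : 16 * sp ^ 2 * r ^ 2 / ε ^ 2 = δ' / 2 := by
    rw [← hq2, hr]
    field_simp
    ring
  rw [finrank_euclideanSpace_fin, hsq, hratio, hlip] at hmain
  simp only [hμ_integral, ← hK, ← hP] at hmain
  have : IsProbabilityMeasure P := hP ▸ inferInstance
  rw [← ofReal_measureReal]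
  exact ENNReal.ofReal_le_ofReal (by linarith)
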